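/- Let T : ℋⁿ → ℋⁿ be an ℝ-linear positive map. Then the least vector of T equals λ(T(I)) ∨_w λ(T*(I)), the join of the eigenvalue vectors of T(I) and T*(I) in the weak-majorization order. -/

import Mathlib

open Matrix
open scoped ComplexOrder

/-- Sum of the `k` largest entries of `p` (as a supremum of sums over `k`-subsets). -/
noncomputable def sumLargest {n : ℕ} (p : Fin n → ℝ) (k : ℕ) : ℝ :=
  sSup ((fun A : Finset (Fin n) => ∑ i ∈ A, p i) '' {A : Finset (Fin n) | A.card = k})

/-- `p` is weakly majorized by `q`. -/
def WeakMaj {n : ℕ} (p q : Fin n → ℝ) : Prop :=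
  ∀ k : ℕ, 1 ≤ k → k ≤ n → sumLargest p k ≤ sumLargest q k

/-- `p` is majorized by `q`. -/
def Maj {n : ℕ} (p q : Fin n → ℝ) : Prop :=
  WeakMaj p q ∧ ∑ i, p i = ∑ i, q i

/-- `p` has nonnegative entries arranged in decreasing order. -/
def DecrNonneg {n : ℕ} (p : Fin n → ℝ) : Prop :=
  Antitone p ∧ ∀ i, 0 ≤ p i

/-- The decreasing rearrangement of a vector. -/
noncomputable def decrRearrange {n : ℕ} (p : Fin n → ℝ) : Fin n → ℝ :=
  fun i => p (Tuple.sort p (Fin.rev i))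

/-- `x` is the supremum of `S` in the weak-majorization order (w-sup). -/
def IsWSup {n : ℕ} (S : Set (Fin n → ℝ)) (x : Fin n → ℝ) : Prop :=
  DecrNonneg x ∧ (∀ s ∈ S, WeakMaj s x) ∧
    ∀ p : Fin n → ℝ, (∀ i, 0 ≤ p i) → (∀ s ∈ S, WeakMaj s p) → WeakMaj x p

/-- `x` is the infimum of `Q` in the weak-majorization order (w-inf). -/
def IsWInf {n : ℕ} (Q : Set (Fin n → ℝ)) (x : Fin n → ℝ) : Prop :=
  DecrNonneg x ∧ (∀ q ∈ Q, WeakMaj x q) ∧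
    ∀ p : Fin n → ℝ, (∀ i, 0 ≤ p i) → (∀ q ∈ Q, WeakMaj p q) → WeakMaj p x

open Classical in
/-- The vector of eigenvalues of a Hermitian matrix, in decreasing order
(junk value `0` if the matrix is not Hermitian). -/
noncomputable def specVec {n : ℕ} (X : Matrix (Fin n) (Fin n) ℂ) : Fin n → ℝ :=
  if h : X.IsHermitian then decrRearrange h.eigenvalues else 0

open Classical in
/-- `λ(|X|)`: the absolute values of the eigenvalues of a Hermitian matrix `X`,
in decreasing order. -/
noncomputable def absSpecVec {n : ℕ} (X : Matrix (Fin n) (Fin n) ℂ) : Fin n → ℝ :=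
  if h : X.IsHermitian then decrRearrange (fun i => |h.eigenvalues i|) else 0

/-- The Jordan product `X ∘ Y = (XY + YX)/2`. -/
noncomputable def jmul {n : ℕ} (X Y : Matrix (Fin n) (Fin n) ℂ) : Matrix (Fin n) (Fin n) ℂ :=
  (2 : ℂ)⁻¹ • (X * Y + Y * X)

/-- A nonzero (orthogonal) projection in `ℋⁿ`. -/
def IsProjection {n : ℕ} (P : Matrix (Fin n) (Fin n) ℂ) : Prop :=
  P.IsHermitian ∧ P * P = P ∧ P ≠ 0

/-- An involution in `ℋⁿ`: a Hermitian matrix with `ε² = I`. -/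
def IsInvolution {n : ℕ} (ε : Matrix (Fin n) (Fin n) ℂ) : Prop :=
  ε.IsHermitian ∧ ε * ε = 1

/-- A positive map: maps positive semidefinite matrices to positive semidefinite matrices. -/
def PositiveMap {n : ℕ} (T : Matrix (Fin n) (Fin n) ℂ → Matrix (Fin n) (Fin n) ℂ) : Prop :=
  ∀ X : Matrix (Fin n) (Fin n) ℂ, X.PosSemidef → (T X).PosSemidef

/-- `S` is the adjoint of `T` with respect to the trace inner product on `ℋⁿ`. -/
def IsAdjointOf {n : ℕ} (S T : Matrix (Fin n) (Fin n) ℂ → Matrix (Fin n) (Fin n) ℂ) : Prop :=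
  ∀ X Y : Matrix (Fin n) (Fin n) ℂ, X.IsHermitian → Y.IsHermitian →
    Matrix.trace (T X * Y) = Matrix.trace (X * S Y)

/-- `q` is the least vector of `T`: `λ(|T(X)|) ≺_w q * λ(|X|)` for all Hermitian `X`,
and `q ≺_w q'` for any other `q' ∈ (ℝⁿ₊)↓` with the same property. -/
def IsLeastVector {n : ℕ} (T : Matrix (Fin n) (Fin n) ℂ → Matrix (Fin n) (Fin n) ℂ)
    (q : Fin n → ℝ) : Prop :=
  DecrNonneg q ∧
  (∀ X : Matrix (Fin n) (Fin n) ℂ, X.IsHermitian →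
    WeakMaj (absSpecVec (T X)) (q * absSpecVec X)) ∧
  ∀ q' : Fin n → ℝ, DecrNonneg q' →
    (∀ X : Matrix (Fin n) (Fin n) ℂ, X.IsHermitian →
      WeakMaj (absSpecVec (T X)) (q' * absSpecVec X)) → WeakMaj q q'

section Vectors

open Finset

variable {n : ℕ}

/-- Sum of the first `m` entries of `p`. -/
def headSum (p : Fin n → ℝ) (m : ℕ) : ℝ :=
  ∑ i : Fin n with i.val < m, p i

lemma headSum_zero (p : Fin n → ℝ) : headSum p 0 = 0 := by
  simp [headSum]

lemma headSum_self (p : Fin n → ℝ) : headSum p n = ∑ i, p i := by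
  simp [headSum]

lemma headSum_succ (p : Fin n → ℝ) {m : ℕ} (hm : m < n) :
    headSum p (m + 1) = headSum p m + p ⟨m, hm⟩ := by
  have h : (univ.filter fun i : Fin n => i.val < m + 1) =
      insert ⟨m, hm⟩ (univ.filter fun i : Fin n => i.val < m) := by
    ext i
    simp only [mem_filter, mem_univ, true_and, mem_insert, Fin.ext_iff]
    omega
  rw [headSum, h, sum_insert (by simp), add_comm, headSum]

lemma headSum_le_sum {p : Fin n → ℝ} (hp : ∀ i, 0 ≤ p i) (m : ℕ) : headSum p m ≤ ∑ i, p i :=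
  sum_le_sum_of_subset_of_nonneg (filter_subset _ _) fun i _ _ => hp i

lemma headSum_le_nat {p : Fin n → ℝ} (hp : ∀ i, p i ≤ 1) {m : ℕ} (hm : m ≤ n) :
    headSum p m ≤ m := by
  refine (sum_le_sum fun i _ => hp i).trans ?_
  simp [Fin.card_filter_val_lt, hm]

lemma headSum_indicator_mul (q : Fin n → ℝ) (k m : ℕ) :
    headSum (fun i => if i.val < k then q i else 0) m = headSum q (min m k) := by
  simp only [headSum, ← sum_filter, filter_filter, lt_min_iff]

lemma headSum_add (p q : Fin n → ℝ) (m : ℕ) :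
    headSum (p + q) m = headSum p m + headSum q m :=
  sum_add_distrib

/-- Abel summation against a vector with nonnegative decreasing entries. -/
lemma sum_mul_nonpos_of_headSum_nonpos {a d : Fin n → ℝ} (ha : DecrNonneg a)
    (hd : ∀ m, 1 ≤ m → m ≤ n → headSum d m ≤ 0) : ∑ i, a i * d i ≤ 0 := by
  have key : ∀ m (hm : m < n),
      headSum (fun i => a i * d i) (m + 1) ≤ a ⟨m, hm⟩ * headSum d (m + 1) := by
    intro m
    induction m with
    | zero => intro hm; simp [headSum_succ _ hm, headSum_zero]
    | succ m ih =>
      intro hm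
      have hanti : a ⟨m + 1, hm⟩ ≤ a ⟨m, by omega⟩ := ha.1 (by simp [Fin.le_def])
      have h := ih (by omega)
      have hneg := hd (m + 1) (by omega) (by omega)
      rw [headSum_succ _ hm, headSum_succ d hm]
      nlinarith
  rw [← headSum_self]
  cases n with
  | zero => simp [headSum]
  | succ n =>
    exact (key n (by omega)).trans
      (mul_nonpos_of_nonneg_of_nonpos (ha.2 _) (hd _ (by omega) le_rfl))

lemma sum_mul_le_of_headSum_le {a b c : Fin n → ℝ} (ha : DecrNonneg a)
    (h : ∀ m, 1 ≤ m → m ≤ n → headSum c m ≤ headSum b m) :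
    ∑ i, a i * c i ≤ ∑ i, a i * b i := by
  have := sum_mul_nonpos_of_headSum_nonpos (d := c - b) ha fun m h1 hm => by
    have := h m h1 hm
    simp only [headSum, Pi.sub_apply, sum_sub_distrib] at this ⊢
    linarith
  simp only [Pi.sub_apply, mul_sub, sum_sub_distrib] at this
  linarith

/-- The maximum of a linear functional over the hypersimplex is attained at the largest
entries. -/
lemma sum_mul_le_headSum {a d : Fin n → ℝ} (ha : DecrNonneg a) (h0 : ∀ i, 0 ≤ d i)
    (h1 : ∀ i, d i ≤ 1) {k : ℕ} (hd : ∑ i, d i ≤ k) :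
    ∑ i, a i * d i ≤ headSum a k := by
  refine (sum_mul_le_of_headSum_le (b := fun i => if i.val < k then 1 else 0) ha
    fun m _ hm => ?_).trans_eq ?_
  · have hmk : headSum (fun i : Fin n => if i.val < k then (1 : ℝ) else 0) m =
        (min m k : ℕ) := by
      rw [headSum_indicator_mul (fun _ => 1), headSum]
      rw [sum_const, Fin.card_filter_val_lt, min_eq_right ((min_le_left m k).trans hm),
        nsmul_one]
    rw [hmk]
    rcases le_total m k with h | h
    · rw [min_eq_left h]
      exact headSum_le_nat h1 hm
    · rw [min_eq_right h]
      exact (headSum_le_sum h0 m).trans hd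
  · simp [headSum, sum_filter]

lemma sum_le_sumLargest (p : Fin n → ℝ) (A : Finset (Fin n)) :
    ∑ i ∈ A, p i ≤ sumLargest p A.card :=
  le_csSup ((Set.toFinite _).image _).bddAbove ⟨A, rfl, rfl⟩

lemma sumLargest_le {p : Fin n → ℝ} {k : ℕ} {c : ℝ} (hk : k ≤ n)
    (h : ∀ A : Finset (Fin n), A.card = k → ∑ i ∈ A, p i ≤ c) : sumLargest p k ≤ c := by
  obtain ⟨A, -, hA⟩ := exists_subset_card_eq (s := (univ : Finset (Fin n))) (by simpa using hk)
  refine csSup_le ⟨_, A, hA, rfl⟩ ?_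
  rintro _ ⟨B, hB, rfl⟩
  exact h B hB

lemma headSum_le_sumLargest (p : Fin n → ℝ) {k : ℕ} (hk : k ≤ n) :
    headSum p k ≤ sumLargest p k := by
  have := sum_le_sumLargest p (univ.filter fun i : Fin n => i.val < k)
  rwa [Fin.card_filter_val_lt, min_eq_right hk] at this

lemma sumLargest_eq_headSum {p : Fin n → ℝ} (hp : DecrNonneg p) {k : ℕ} (hk : k ≤ n) :
    sumLargest p k = headSum p k := by
  refine le_antisymm (sumLargest_le hk fun A hA => ?_) (headSum_le_sumLargest p hk)
  have := sum_mul_le_headSum (k := k) (d := fun i => if i ∈ A then 1 else 0) hp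
    (fun i => by split_ifs <;> norm_num) (fun i => by split_ifs <;> norm_num) (by simp [hA])
  simpa using this

lemma weakMaj_iff_headSum {p q : Fin n → ℝ} (hp : DecrNonneg p) (hq : DecrNonneg q) :
    WeakMaj p q ↔ ∀ k ≤ n, headSum p k ≤ headSum q k := by
  refine ⟨fun h k hk => ?_, fun h k _ hk => ?_⟩
  · rcases Nat.eq_zero_or_pos k with rfl | h0
    · simp [headSum_zero]
    · simpa only [sumLargest_eq_headSum hp hk, sumLargest_eq_headSum hq hk] using h k h0 hk
  · simpa only [sumLargest_eq_headSum hp hk, sumLargest_eq_headSum hq hk] using h k hk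

/-- The permutation that puts the entries of `p` in decreasing order. -/
noncomputable def decrPerm (p : Fin n → ℝ) : Equiv.Perm (Fin n) :=
  Fin.revPerm.trans (Tuple.sort p)

lemma decrRearrange_apply (p : Fin n → ℝ) (i : Fin n) : decrRearrange p i = p (decrPerm p i) :=
  rfl

lemma decrNonneg_decrRearrange {p : Fin n → ℝ} (hp : ∀ i, 0 ≤ p i) :
    DecrNonneg (decrRearrange p) :=
  ⟨fun _ _ h => Tuple.monotone_sort p (Fin.rev_le_rev.mpr h), fun _ => hp _⟩

lemma sumLargest_decrRearrange (p : Fin n → ℝ) {k : ℕ} (hk : k ≤ n) :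
    sumLargest (decrRearrange p) k = sumLargest p k := by
  refine le_antisymm (sumLargest_le hk fun A hA => ?_) (sumLargest_le hk fun A hA => ?_)
  · have := sum_le_sumLargest p (A.map (decrPerm p).toEmbedding)
    simpa [hA, decrRearrange_apply] using this
  · have := sum_le_sumLargest (decrRearrange p) (A.map (decrPerm p).symm.toEmbedding)
    simpa [hA, decrRearrange_apply] using this

/-- The join of two decreasing nonnegative vectors in the weak-majorization order exists. -/
lemma exists_isWSup_pair {r s : Fin n → ℝ} (hr : DecrNonneg r) (hs : DecrNonneg s) :
    ∃ q, IsWSup {r, s} q := by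
  let B : Set (Fin n → ℝ) := {p | DecrNonneg p ∧ ∀ k ≤ n, headSum r k ≤ headSum p k ∧
    headSum s k ≤ headSum p k}
  have headSum_nonneg : ∀ {p : Fin n → ℝ}, DecrNonneg p → ∀ k, 0 ≤ headSum p k :=
    fun hp k => sum_nonneg fun i _ => hp.2 i
  have hrs : r + s ∈ B := by
    refine ⟨⟨hr.1.add hs.1, fun i => add_nonneg (hr.2 i) (hs.2 i)⟩, fun k _ => ?_⟩
    rw [headSum_add]
    constructor <;> linarith [headSum_nonneg hr k, headSum_nonneg hs k]
  have : Nonempty B := ⟨⟨_, hrs⟩⟩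
  let Q : ℕ → ℝ := fun k => ⨅ p : B, headSum p.1 k
  have hQle : ∀ k, ∀ p ∈ B, Q k ≤ headSum p k := fun k p hp =>
    ciInf_le (f := fun p : B => headSum p.1 k)
      ⟨0, by rintro _ ⟨p, rfl⟩; exact headSum_nonneg p.2.1 k⟩ ⟨p, hp⟩
  have hleQ : ∀ k c, (∀ p ∈ B, c ≤ headSum p k) → c ≤ Q k := fun k c h =>
    le_ciInf fun p => h p.1 p.2
  let q : Fin n → ℝ := fun i => Q (i + 1) - Q i
  have hq : ∀ k ≤ n, headSum q k = Q k := by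
    intro k
    induction k with
    | zero => intro _; simp [Q, headSum_zero]
    | succ k ih =>
      intro hk
      rw [headSum_succ _ (by omega), ih (by omega)]
      simp [q]
  have hmono : ∀ k < n, Q k ≤ Q (k + 1) := fun k hk => hleQ _ _ fun p hp => by
    have := hQle k p hp
    rw [headSum_succ p hk]
    linarith [hp.1.2 ⟨k, hk⟩]
  have hconc : ∀ k, k + 1 < n → Q (k + 2) - Q (k + 1) ≤ Q (k + 1) - Q k := by
    intro k hk
    suffices (Q k + Q (k + 2)) / 2 ≤ Q (k + 1) by linarith
    refine hleQ _ _ fun p hp => ?_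
    have h0 := hQle k p hp
    have h2 := hQle (k + 2) p hp
    have hanti : p ⟨k + 1, hk⟩ ≤ p ⟨k, by omega⟩ := hp.1.1 (by simp [Fin.le_def])
    rw [headSum_succ p (by omega : k + 1 < n)] at h2
    have h1 := headSum_succ p (by omega : k < n)
    linarith
  have hqB : DecrNonneg q := by
    refine ⟨?_, fun i => sub_nonneg.2 (hmono i i.2)⟩
    cases n with
    | zero => exact fun i => i.elim0
    | succ n => exact Fin.antitone_iff_succ_le.2 fun i => hconc i (by omega)
  refine ⟨q, hqB, ?_, fun p hp hmaj => ?_⟩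
  · rintro t (rfl | rfl)
    · rw [weakMaj_iff_headSum hr hqB]
      intro k hk
      rw [hq k hk]
      exact hleQ _ _ fun p hp => (hp.2 k hk).1
    · rw [weakMaj_iff_headSum hs hqB]
      intro k hk
      rw [hq k hk]
      exact hleQ _ _ fun p hp => (hp.2 k hk).2
  · have hp' := decrNonneg_decrRearrange hp
    have hle : ∀ t, DecrNonneg t → t ∈ ({r, s} : Set (Fin n → ℝ)) →
        ∀ k ≤ n, headSum t k ≤ headSum (decrRearrange p) k := by
      intro t ht htm
      rw [← weakMaj_iff_headSum ht hp']
      intro k h1 hk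
      rw [sumLargest_decrRearrange p hk]
      exact hmaj t htm k h1 hk
    intro k _ hk
    rw [sumLargest_eq_headSum hqB hk, hq k hk, ← sumLargest_decrRearrange p hk,
      sumLargest_eq_headSum hp' hk]
    exact hQle k _ ⟨hp', fun k hk => ⟨hle r hr (by simp) k hk, hle s hs (by simp) k hk⟩⟩

end Vectors

section Matrices

open Finset

variable {n : ℕ}

/-- A family of pairwise orthogonal rank-one projections that sums to the identity. -/
structure IsFrame (P : Fin n → Matrix (Fin n) (Fin n) ℂ) : Prop where
  posSemidef : ∀ i, (P i).PosSemidef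
  mul_self : ∀ i, P i * P i = P i
  mul_of_ne : ∀ i j, i ≠ j → P i * P j = 0
  trace_eq_one : ∀ i, (P i).trace = 1
  sum_eq_one : ∑ i, P i = 1

lemma IsFrame.comp_equiv {P : Fin n → Matrix (Fin n) (Fin n) ℂ} (hP : IsFrame P)
    (σ : Equiv.Perm (Fin n)) : IsFrame (P ∘ σ) where
  posSemidef _ := hP.posSemidef _
  mul_self _ := hP.mul_self _
  mul_of_ne i j h := hP.mul_of_ne _ _ (σ.injective.ne h)
  trace_eq_one _ := hP.trace_eq_one _
  sum_eq_one := by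
    rw [← hP.sum_eq_one]
    exact Equiv.sum_comp σ P

lemma IsFrame.trace_mul_nonneg {P : Fin n → Matrix (Fin n) (Fin n) ℂ} (hP : IsFrame P)
    {A : Matrix (Fin n) (Fin n) ℂ} (hA : A.PosSemidef) (i : Fin n) :
    0 ≤ (A * P i).trace.re := by
  have h := (hA.mul_mul_conjTranspose_same (P i)).trace_nonneg
  rw [(hP.posSemidef i).isHermitian.eq, Matrix.trace_mul_comm, ← Matrix.mul_assoc, hP.mul_self,
    Matrix.trace_mul_comm] at h
  exact (Complex.le_def.1 h).1

lemma IsFrame.sum_trace_mul {P : Fin n → Matrix (Fin n) (Fin n) ℂ} (hP : IsFrame P)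
    (A : Matrix (Fin n) (Fin n) ℂ) : ∑ i, (A * P i).trace.re = A.trace.re := by
  rw [← Complex.re_sum, ← Matrix.trace_sum, ← Matrix.mul_sum, hP.sum_eq_one, Matrix.mul_one]

lemma IsFrame.trace_sum_smul_mul {P : Fin n → Matrix (Fin n) (Fin n) ℂ} (hP : IsFrame P)
    (x : Fin n → ℝ) (i : Fin n) : ((∑ j, x j • P j) * P i).trace.re = x i := by
  rw [Matrix.sum_mul, Finset.sum_eq_single i]
  · simp [hP.mul_self, hP.trace_eq_one]
  · intro j _ hj
    simp [hP.mul_of_ne j i hj]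
  · simp

lemma trace_sum_smul_mul (P : Fin n → Matrix (Fin n) (Fin n) ℂ) (x : Fin n → ℝ)
    (B : Matrix (Fin n) (Fin n) ℂ) :
    ((∑ j, x j • P j) * B).trace.re = ∑ j, x j * (P j * B).trace.re := by
  simp [Matrix.sum_mul, Matrix.trace_sum, Complex.re_sum]

/-- Spectral decomposition along a frame. -/
lemma exists_frame_eigenvalues {H : Matrix (Fin n) (Fin n) ℂ} (hH : H.IsHermitian) :
    ∃ P, IsFrame P ∧ H = ∑ i, hH.eigenvalues i • P i := by
  let U : Matrix (Fin n) (Fin n) ℂ := hH.eigenvectorUnitary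
  have hU : star U * U = 1 := Unitary.coe_star_mul_self _
  have hU' : U * star U = 1 := Unitary.coe_mul_star_self _
  have hmul : ∀ A B : Matrix (Fin n) (Fin n) ℂ,
      U * A * star U * (U * B * star U) = U * (A * B) * star U := fun A B => by
    calc _ = U * A * (star U * U) * B * star U := by simp only [Matrix.mul_assoc]
      _ = _ := by rw [hU]; simp only [Matrix.mul_assoc, Matrix.mul_one]
  refine ⟨fun i => U * Matrix.single i i 1 * star U, ⟨fun i => ?_, fun i => ?_, fun i j hij => ?_,
    fun i => ?_, ?_⟩, ?_⟩
  · have h : (Matrix.single i i (1 : ℂ)).PosSemidef := by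
      rw [← Matrix.diagonal_single]
      refine Matrix.PosSemidef.diagonal fun j => ?_
      by_cases h : j = i
      · subst h; simp
      · simp [h]
    exact h.mul_mul_conjTranspose_same U
  · simp [hmul]
  · simp [hmul, hij]
  · rw [Matrix.trace_mul_comm, ← Matrix.mul_assoc, hU, Matrix.one_mul, Matrix.trace_single_eq_same]
  · rw [← Matrix.sum_mul, ← Matrix.mul_sum, Matrix.sum_single_one, Matrix.mul_one, hU']
  · conv_lhs => rw [hH.spectral_theorem, Unitary.conjStarAlgAut_apply]
    rw [← Matrix.sum_single_eq_diagonal, Matrix.mul_sum, Matrix.sum_mul]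
    refine Finset.sum_congr rfl fun i _ => ?_
    have : Matrix.single i i ((RCLike.ofReal ∘ hH.eigenvalues) i : ℂ) =
        hH.eigenvalues i • Matrix.single i i (1 : ℂ) := by
      simp [Matrix.smul_single]
    rw [this, Matrix.mul_smul, Matrix.smul_mul]

lemma exists_frame_specVec {H : Matrix (Fin n) (Fin n) ℂ} (hH : H.IsHermitian) :
    ∃ P, IsFrame P ∧ H = ∑ i, specVec H i • P i := by
  obtain ⟨P, hP, h⟩ := exists_frame_eigenvalues hH
  refine ⟨_, hP.comp_equiv (decrPerm hH.eigenvalues), ?_⟩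
  simp only [specVec, dif_pos hH, decrRearrange_apply, Function.comp_apply]
  rwa [Equiv.sum_comp (decrPerm hH.eigenvalues) fun i => hH.eigenvalues i • P i]

lemma exists_frame_absSpecVec {H : Matrix (Fin n) (Fin n) ℂ} (hH : H.IsHermitian) :
    ∃ (P : Fin n → Matrix (Fin n) (Fin n) ℂ) (x : Fin n → ℝ),
      IsFrame P ∧ H = ∑ i, x i • P i ∧ ∀ i, absSpecVec H i = |x i| := by
  obtain ⟨P, hP, h⟩ := exists_frame_eigenvalues hH
  let σ := decrPerm fun i => |hH.eigenvalues i|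
  refine ⟨_, hH.eigenvalues ∘ σ, hP.comp_equiv σ, ?_, fun i => ?_⟩
  · simp only [Function.comp_apply]
    rwa [Equiv.sum_comp σ fun i => hH.eigenvalues i • P i]
  · simp only [absSpecVec, dif_pos hH, decrRearrange_apply, Function.comp_apply, σ]

lemma decrNonneg_absSpecVec (H : Matrix (Fin n) (Fin n) ℂ) : DecrNonneg (absSpecVec H) := by
  unfold absSpecVec
  split_ifs
  · exact decrNonneg_decrRearrange fun _ => abs_nonneg _
  · exact ⟨antitone_const, fun _ => le_rfl⟩

lemma decrNonneg_specVec {H : Matrix (Fin n) (Fin n) ℂ} (hH : H.PosSemidef) :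
    DecrNonneg (specVec H) := by
  rw [specVec, dif_pos hH.isHermitian]
  exact decrNonneg_decrRearrange hH.eigenvalues_nonneg

lemma absSpecVec_eq_specVec {H : Matrix (Fin n) (Fin n) ℂ} (hH : H.PosSemidef) :
    absSpecVec H = specVec H := by
  simp [absSpecVec, specVec, dif_pos hH.isHermitian, abs_of_nonneg (hH.eigenvalues_nonneg _)]

/-- Ky Fan's maximum principle, the upper bound. -/
lemma sum_trace_mul_le_headSum_specVec {H : Matrix (Fin n) (Fin n) ℂ} (hH : H.PosSemidef)
    {P : Fin n → Matrix (Fin n) (Fin n) ℂ} (hP : IsFrame P) (A : Finset (Fin n)) :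
    ∑ l ∈ A, (H * P l).trace.re ≤ headSum (specVec H) A.card := by
  obtain ⟨W, hW, h⟩ := exists_frame_specVec hH.isHermitian
  have hnn : ∀ j l, 0 ≤ (W j * P l).trace.re := fun j l =>
    hP.trace_mul_nonneg (hW.posSemidef j) l
  calc ∑ l ∈ A, (H * P l).trace.re
      = ∑ j, specVec H j * ∑ l ∈ A, (W j * P l).trace.re := by
        conv_lhs => rw [h]
        simp only [trace_sum_smul_mul, Finset.mul_sum]
        exact Finset.sum_comm
    _ ≤ _ := by
        refine sum_mul_le_headSum (decrNonneg_specVec hH) (fun j => sum_nonneg fun l _ => hnn j l)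
          (fun j => ?_) ?_
        · refine (sum_le_univ_sum_of_nonneg (hnn j)).trans_eq ?_
          rw [hP.sum_trace_mul, hW.trace_eq_one, Complex.one_re]
        · rw [Finset.sum_comm]
          refine (Finset.sum_le_card_nsmul A _ 1 fun l _ => ?_).trans_eq (by simp)
          simp only [Matrix.trace_mul_comm (W _)]
          rw [hW.sum_trace_mul, hP.trace_eq_one, Complex.one_re]

lemma posSemidef_adjoint_one {T T' : Matrix (Fin n) (Fin n) ℂ → Matrix (Fin n) (Fin n) ℂ}
    (hTpos : PositiveMap T) (hT' : ∀ X, X.IsHermitian → (T' X).IsHermitian)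
    (hadj : IsAdjointOf T' T) : (T' 1).PosSemidef := by
  have hH := hT' 1 Matrix.isHermitian_one
  obtain ⟨P, hP, h⟩ := exists_frame_eigenvalues hH
  refine hH.posSemidef_iff_eigenvalues_nonneg.2 fun i => ?_
  have h1 := hP.trace_sum_smul_mul hH.eigenvalues i
  rw [← h, Matrix.trace_mul_comm, ← hadj _ _ (hP.posSemidef i).isHermitian Matrix.isHermitian_one,
    Matrix.mul_one] at h1
  rw [Pi.zero_apply, ← h1]
  exact (Complex.le_def.1 (hTpos _ (hP.posSemidef i)).trace_nonneg).1

/-- A vector bounding the eigenvalues of `T 1` and of `T' 1` controls every `T X`. -/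
lemma weakMaj_absSpecVec_map {T T' : Matrix (Fin n) (Fin n) ℂ → Matrix (Fin n) (Fin n) ℂ}
    (hTlin : IsLinearMap ℝ T) (hTpos : PositiveMap T)
    (hT : ∀ X, X.IsHermitian → (T X).IsHermitian)
    (hT' : ∀ X, X.IsHermitian → (T' X).IsHermitian) (hadj : IsAdjointOf T' T)
    {q : Fin n → ℝ} (hq : DecrNonneg q) (h1 : WeakMaj (specVec (T 1)) q)
    (h2 : WeakMaj (specVec (T' 1)) q) {X : Matrix (Fin n) (Fin n) ℂ} (hX : X.IsHermitian) :
    WeakMaj (absSpecVec (T X)) (q * absSpecVec X) := by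
  have hT1 : (T 1).PosSemidef := hTpos 1 Matrix.PosSemidef.one
  have hT'1 := posSemidef_adjoint_one hTpos hT' hadj
  rw [weakMaj_iff_headSum (decrNonneg_specVec hT1) hq] at h1
  rw [weakMaj_iff_headSum (decrNonneg_specVec hT'1) hq] at h2
  obtain ⟨U, x, hU, hXx, hx⟩ := exists_frame_absSpecVec hX
  obtain ⟨V, y, hV, hTy, hy⟩ := exists_frame_absSpecVec (hT X hX)
  let D : Fin n → Fin n → ℝ := fun l i => (T (U i) * V l).trace.re
  have hD : ∀ l i, 0 ≤ D l i := fun l i => hV.trace_mul_nonneg (hTpos _ (hU.posSemidef i)) l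
  have hTsum : ∀ c : Fin n → ℝ, T (∑ i, c i • U i) = ∑ i, c i • T (U i) := fun c => by
    simp only [← hTlin.map_smul]
    exact map_sum (hTlin.mk' T) (fun i => c i • U i) univ
  have hrow : ∀ l, ∑ i, D l i = (T 1 * V l).trace.re := fun l => by
    have := hTsum 1
    simp only [Pi.one_apply, one_smul, hU.sum_eq_one] at this
    rw [this, Matrix.sum_mul, Matrix.trace_sum, Complex.re_sum]
  have hcol : ∀ i, ∑ l, D l i = (T' 1 * U i).trace.re := fun i => by
    rw [hV.sum_trace_mul, Matrix.trace_mul_comm,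
      ← hadj _ _ (hU.posSemidef i).isHermitian Matrix.isHermitian_one, Matrix.mul_one]
  have hylx : ∀ l, |y l| ≤ ∑ i, |x i| * D l i := fun l => by
    have : y l = ∑ i, x i * D l i := by
      rw [← hV.trace_sum_smul_mul y l, ← hTy]
      conv_lhs => rw [hXx, hTsum, trace_sum_smul_mul]
    rw [this]
    refine (abs_sum_le_sum_abs _ _).trans_eq (sum_congr rfl fun i _ => ?_)
    rw [abs_mul, abs_of_nonneg (hD l i)]
  intro k _ hk
  refine sumLargest_le hk fun A hA => ?_
  calc ∑ l ∈ A, absSpecVec (T X) l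
      ≤ ∑ l ∈ A, ∑ i, |x i| * D l i := sum_le_sum fun l _ => (hy l).trans_le (hylx l)
    _ = ∑ i, absSpecVec X i * ∑ l ∈ A, D l i := by
        rw [Finset.sum_comm]
        simp only [hx, Finset.mul_sum]
    _ ≤ ∑ i, absSpecVec X i * (if i.val < k then q i else 0) := by
        refine sum_mul_le_of_headSum_le (decrNonneg_absSpecVec X) fun m _ hm => ?_
        rw [headSum_indicator_mul]
        rcases le_total m k with h | h
        · rw [min_eq_left h]
          calc headSum (fun i => ∑ l ∈ A, D l i) m
              ≤ ∑ i : Fin n with i.val < m, (T' 1 * U i).trace.re :=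
                sum_le_sum fun i _ => (sum_le_univ_sum_of_nonneg fun l => hD l i).trans_eq (hcol i)
            _ ≤ headSum (specVec (T' 1)) m := by
                refine (sum_trace_mul_le_headSum_specVec hT'1 hU _).trans_eq ?_
                rw [Fin.card_filter_val_lt, min_eq_right hm]
            _ ≤ headSum q m := h2 m hm
        · rw [min_eq_right h]
          calc headSum (fun i => ∑ l ∈ A, D l i) m
              ≤ ∑ i, ∑ l ∈ A, D l i := headSum_le_sum (fun i => sum_nonneg fun l _ => hD l i) m
            _ = ∑ l ∈ A, (T 1 * V l).trace.re := by
                rw [Finset.sum_comm]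
                exact sum_congr rfl fun l _ => hrow l
            _ ≤ headSum (specVec (T 1)) k := hA ▸ sum_trace_mul_le_headSum_specVec hT1 hV A
            _ ≤ headSum q k := h1 k hk
    _ = headSum (q * absSpecVec X) k := by
        simp [headSum, sum_filter, mul_comm]
    _ ≤ sumLargest (q * absSpecVec X) k := headSum_le_sumLargest _ hk

lemma absSpecVec_one : absSpecVec (1 : Matrix (Fin n) (Fin n) ℂ) = 1 := by
  obtain ⟨P, x, hP, h, hx⟩ := exists_frame_absSpecVec (Matrix.isHermitian_one (n := Fin n) (α := ℂ))
  ext i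
  have := hP.trace_sum_smul_mul x i
  rw [← h, Matrix.one_mul, hP.trace_eq_one, Complex.one_re] at this
  simp [hx, ← this]

lemma IsFrame.absSpecVec_sum_mem_hypersimplex {P : Fin n → Matrix (Fin n) (Fin n) ℂ}
    (hP : IsFrame P) (A : Finset (Fin n)) :
    (∀ i, absSpecVec (∑ l ∈ A, P l) i ≤ 1) ∧ ∑ i, absSpecVec (∑ l ∈ A, P l) i = A.card := by
  have hpos : (∑ l ∈ A, P l).PosSemidef := Matrix.posSemidef_sum A fun l _ => hP.posSemidef l
  obtain ⟨W, x, hW, h, hx⟩ := exists_frame_absSpecVec hpos.isHermitian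
  have hnn : ∀ i l, 0 ≤ (W i * P l).trace.re := fun i l =>
    hP.trace_mul_nonneg (hW.posSemidef i) l
  have hxi : ∀ i, absSpecVec (∑ l ∈ A, P l) i = ∑ l ∈ A, (W i * P l).trace.re := fun i => by
    have h1 := hW.trace_sum_smul_mul x i
    rw [← h, Matrix.trace_mul_comm, Matrix.mul_sum, Matrix.trace_sum, Complex.re_sum] at h1
    rw [hx, ← h1, abs_of_nonneg (sum_nonneg fun l _ => hnn i l)]
  simp only [hxi]
  refine ⟨fun i => ?_, ?_⟩
  · refine (sum_le_univ_sum_of_nonneg (hnn i)).trans_eq ?_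
    rw [hP.sum_trace_mul, hW.trace_eq_one, Complex.one_re]
  · rw [Finset.sum_comm]
    simp only [Matrix.trace_mul_comm (W _), hW.sum_trace_mul, hP.trace_eq_one, Complex.one_re]
    simp

/-- Testing on sums of spectral projections of `T' 1` bounds its eigenvalues. -/
lemma specVec_adjoint_one_weakMaj
    {T T' : Matrix (Fin n) (Fin n) ℂ → Matrix (Fin n) (Fin n) ℂ} (hTpos : PositiveMap T)
    (hT' : ∀ X, X.IsHermitian → (T' X).IsHermitian) (hadj : IsAdjointOf T' T)
    {q : Fin n → ℝ} (hq : DecrNonneg q)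
    (h : ∀ X, X.IsHermitian → WeakMaj (absSpecVec (T X)) (q * absSpecVec X)) :
    WeakMaj (specVec (T' 1)) q := by
  obtain ⟨P, hP, hT'P⟩ := exists_frame_specVec (hT' 1 Matrix.isHermitian_one)
  intro k h1 hk
  refine sumLargest_le hk fun A hA => ?_
  have hpos : (∑ l ∈ A, P l).PosSemidef := Matrix.posSemidef_sum A fun l _ => hP.posSemidef l
  have hTA := hTpos _ hpos
  have hn := h _ hpos.isHermitian n (h1.trans hk) le_rfl
  obtain ⟨W, hW, hTW⟩ := exists_frame_specVec hTA.isHermitian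
  obtain ⟨hle, hsum⟩ := hP.absSpecVec_sum_mem_hypersimplex A
  have ha := decrNonneg_absSpecVec (∑ l ∈ A, P l)
  have hqa : DecrNonneg (q * absSpecVec (∑ l ∈ A, P l)) :=
    ⟨fun i j hij => mul_le_mul (hq.1 hij) (ha.1 hij) (ha.2 _) (hq.2 _),
      fun i => mul_nonneg (hq.2 i) (ha.2 i)⟩
  calc ∑ i ∈ A, specVec (T' 1) i
      = ((∑ l ∈ A, P l) * T' 1).trace.re := by
        rw [Matrix.sum_mul, Matrix.trace_sum, Complex.re_sum]
        refine sum_congr rfl fun i _ => ?_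
        rw [Matrix.trace_mul_comm, ← hP.trace_sum_smul_mul (specVec (T' 1)) i, ← hT'P]
    _ = (T (∑ l ∈ A, P l)).trace.re := by
        rw [← hadj _ _ hpos.isHermitian Matrix.isHermitian_one, Matrix.mul_one]
    _ = ∑ i, absSpecVec (T (∑ l ∈ A, P l)) i := by
        rw [absSpecVec_eq_specVec hTA, ← hW.sum_trace_mul]
        refine sum_congr rfl fun i _ => ?_
        rw [← hW.trace_sum_smul_mul (specVec (T (∑ l ∈ A, P l))) i, ← hTW]
    _ ≤ ∑ i, q i * absSpecVec (∑ l ∈ A, P l) i := by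
        rwa [sumLargest_eq_headSum (decrNonneg_absSpecVec _) le_rfl,
          sumLargest_eq_headSum hqa le_rfl, headSum_self, headSum_self] at hn
    _ ≤ headSum q k := sum_mul_le_headSum hq ha.2 hle (by rw [hsum, hA])
    _ ≤ sumLargest q k := headSum_le_sumLargest q hk

end Matrices

theorem least_vector_of_positive_eq_join (n : ℕ) (T T' : Matrix (Fin n) (Fin n) ℂ → Matrix (Fin n) (Fin n) ℂ)
    (hTlin : IsLinearMap ℝ T) (hT'lin : IsLinearMap ℝ T')
    (hTpos : PositiveMap T)
    (hT : ∀ X : Matrix (Fin n) (Fin n) ℂ, X.IsHermitian → (T X).IsHermitian)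
    (hT' : ∀ X : Matrix (Fin n) (Fin n) ℂ, X.IsHermitian → (T' X).IsHermitian)
    (hadj : IsAdjointOf T' T) :
    ∃ q : Fin n → ℝ, IsLeastVector T q ∧
      IsWSup {specVec (T 1), specVec (T' 1)} q := by
  have hT1 : (T 1).PosSemidef := hTpos 1 Matrix.PosSemidef.one
  have hT'1 := posSemidef_adjoint_one hTpos hT' hadj
  obtain ⟨q, hq⟩ := exists_isWSup_pair (decrNonneg_specVec hT1) (decrNonneg_specVec hT'1)
  refine ⟨q, ⟨hq.1, fun X hX => weakMaj_absSpecVec_map hTlin hTpos hT hT' hadj hq.1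
    (hq.2.1 _ (by simp)) (hq.2.1 _ (by simp)) hX, fun q' hq' h => hq.2.2 q' hq'.2 ?_⟩, hq⟩
  rintro s (rfl | rfl)
  · have := h 1 Matrix.isHermitian_one
    rwa [absSpecVec_one, mul_one, absSpecVec_eq_specVec hT1] at this
  · exact specVec_adjoint_one_weakMaj hTpos hT' hadj hq' h
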